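/- arXiv:2510.25001 — 3 statements merged into one kernel-verified Lean document; each statement's English description precedes it below -/
import Mathlib

section
/- For all constants 0 < σ_min < σ_max < ∞ there exists a constant C₀ > 0, depending only on σ_min and σ_max, such that for all μ, μ̃ ∈ ℝ and all σ, σ̃ ∈ [σ_min, σ_max], D_KL(N(μ,σ²) ‖ N(μ̃,σ̃²)) ≤ C₀ · ((μ − μ̃)² + (σ − σ̃)²). -/
open MeasureTheory ProbabilityTheory
open scoped Classical

/-- KL divergence `∫ log (dP/dQ) dP`, with value `⊤` if `P` is not absolutely
continuous with respect to `Q` or the log-likelihood ratio is not integrable. -/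
noncomputable def klDiv {α : Type*} [MeasurableSpace α] (P Q : Measure α) : EReal :=
  if P ≪ Q ∧ Integrable (fun x => Real.log (P.rnDeriv Q x).toReal) P
  then ((∫ x, Real.log (P.rnDeriv Q x).toReal ∂P : ℝ) : EReal)
  else ⊤

/-- The Gaussian probability measure `N(μ, σ²)` on `ℝ`. -/
noncomputable def gaussian (μ σ : ℝ) : Measure ℝ := gaussianReal μ (σ ^ 2).toNNReal

open scoped NNReal

lemma log_gaussianPDFReal (μ : ℝ) {v : ℝ≥0} (hv : v ≠ 0) (x : ℝ) :
    Real.log (gaussianPDFReal μ v x) =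
      -Real.log (2 * Real.pi * v) / 2 - (x - μ) ^ 2 / (2 * v) := by
  have hv' : (0 : ℝ) < v := by positivity
  rw [gaussianPDFReal, Real.log_mul (by positivity) (Real.exp_ne_zero _), Real.log_exp,
    Real.log_inv, Real.log_sqrt (by positivity)]
  ring

lemma log_rnDeriv_gaussianReal_ae_eq (μ₁ μ₂ : ℝ) {v₁ v₂ : ℝ≥0} (hv₁ : v₁ ≠ 0) (hv₂ : v₂ ≠ 0) :
    (fun x ↦ Real.log ((gaussianReal μ₁ v₁).rnDeriv (gaussianReal μ₂ v₂) x).toReal)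
      =ᵐ[gaussianReal μ₁ v₁] fun x ↦ (Real.log v₂ - Real.log v₁) / 2
        - (x - μ₁) ^ 2 / (2 * v₁) + (x - μ₂) ^ 2 / (2 * v₂) := by
  have hac : gaussianReal μ₁ v₁ ≪ gaussianReal μ₂ v₂ :=
    (gaussianReal_absolutelyContinuous μ₁ hv₁).trans (gaussianReal_absolutelyContinuous' μ₂ hv₂)
  have hvol := gaussianReal_absolutelyContinuous μ₁ hv₁
  filter_upwards [hvol.ae_le (Measure.rnDeriv_mul_rnDeriv (κ := volume) hac),
    hvol.ae_le (rnDeriv_gaussianReal μ₁ v₁), hvol.ae_le (rnDeriv_gaussianReal μ₂ v₂)]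
    with x hx hx₁ hx₂
  rw [Pi.mul_apply, hx₁, hx₂] at hx
  have h := congrArg ENNReal.toReal hx
  rw [ENNReal.toReal_mul, toReal_gaussianPDF, toReal_gaussianPDF] at h
  have hp₁ := gaussianPDFReal_pos μ₁ v₁ x hv₁
  have hp₂ := gaussianPDFReal_pos μ₂ v₂ x hv₂
  have hpos₁ : (0 : ℝ) < v₁ := by positivity
  have hpos₂ : (0 : ℝ) < v₂ := by positivity
  rw [← eq_div_iff hp₂.ne'] at h
  rw [h, Real.log_div hp₁.ne' hp₂.ne', log_gaussianPDFReal μ₁ hv₁, log_gaussianPDFReal μ₂ hv₂,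
    Real.log_mul (by positivity) hpos₁.ne', Real.log_mul (by positivity) hpos₂.ne']
  ring

lemma integrable_sub_sq_gaussianReal (μ c : ℝ) (v : ℝ≥0) :
    Integrable (fun x ↦ (x - c) ^ 2) (gaussianReal μ v) :=
  ((memLp_id_gaussianReal 2).sub (memLp_const c)).integrable_sq

lemma integral_sub_sq_gaussianReal (μ c : ℝ) (v : ℝ≥0) :
    ∫ x, (x - c) ^ 2 ∂gaussianReal μ v = v + (μ - c) ^ 2 := by
  have hid : Integrable (fun x : ℝ ↦ x) (gaussianReal μ v) :=
    (memLp_id_gaussianReal 1).integrable le_rfl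
  have hvar : ∫ x, (x - μ) ^ 2 ∂gaussianReal μ v = v := by
    rw [← variance_fun_id_gaussianReal (μ := μ) (v := v),
      variance_eq_integral aemeasurable_id', integral_id_gaussianReal]
  have hlin : Integrable (fun x : ℝ ↦ 2 * (μ - c) * (x - μ)) (gaussianReal μ v) :=
    (hid.sub (integrable_const μ)).const_mul _
  have hadd : Integrable (fun x ↦ (x - μ) ^ 2 + 2 * (μ - c) * (x - μ)) (gaussianReal μ v) :=
    (integrable_sub_sq_gaussianReal μ μ v).add hlin
  calc ∫ x, (x - c) ^ 2 ∂gaussianReal μ v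
      = ∫ x, ((x - μ) ^ 2 + 2 * (μ - c) * (x - μ) + (μ - c) ^ 2) ∂gaussianReal μ v := by
        congr with x; ring
    _ = v + (μ - c) ^ 2 := by
        rw [integral_add hadd (integrable_const _),
          integral_add (integrable_sub_sq_gaussianReal μ μ v) hlin, hvar, integral_const_mul,
          integral_sub hid (integrable_const μ), integral_id_gaussianReal]
        simp

/-- Closed form of the Kullback–Leibler divergence between Gaussian measures. -/
lemma klDiv_gaussianReal (μ₁ μ₂ : ℝ) {v₁ v₂ : ℝ≥0} (hv₁ : v₁ ≠ 0) (hv₂ : v₂ ≠ 0) :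
    klDiv (gaussianReal μ₁ v₁) (gaussianReal μ₂ v₂) =
      (((Real.log v₂ - Real.log v₁) / 2 - 1 / 2 + (v₁ + (μ₁ - μ₂) ^ 2) / (2 * v₂) : ℝ) :
        EReal) := by
  have hac : gaussianReal μ₁ v₁ ≪ gaussianReal μ₂ v₂ :=
    (gaussianReal_absolutelyContinuous μ₁ hv₁).trans (gaussianReal_absolutelyContinuous' μ₂ hv₂)
  have hlog := log_rnDeriv_gaussianReal_ae_eq μ₁ μ₂ hv₁ hv₂
  have hint₁ := (integrable_sub_sq_gaussianReal μ₁ μ₁ v₁).div_const (2 * v₁)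
  have hint₂ := (integrable_sub_sq_gaussianReal μ₁ μ₂ v₁).div_const (2 * v₂)
  have hconst := integrable_const (μ := gaussianReal μ₁ v₁) ((Real.log v₂ - Real.log v₁) / 2)
  have hsub : Integrable (fun x ↦ (Real.log v₂ - Real.log v₁) / 2 - (x - μ₁) ^ 2 / (2 * v₁))
      (gaussianReal μ₁ v₁) := hconst.sub hint₁
  have hpos : (0 : ℝ) < v₁ := by positivity
  rw [klDiv, if_pos ⟨hac, (hsub.add hint₂).congr hlog.symm⟩, integral_congr_ae hlog,
    integral_add hsub hint₂, integral_sub hconst hint₁, integral_const, integral_div, integral_div,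
    integral_sub_sq_gaussianReal, integral_sub_sq_gaussianReal]
  congr 1
  simp
  field_simp

/-- Quadratic upper bound for the variance part of the Gaussian divergence. -/
lemma log_sub_log_add_sq_div_le {σ τ : ℝ} (hσ : 0 < σ) (hτ : 0 < τ) :
    Real.log τ - Real.log σ - 1 / 2 + σ ^ 2 / (2 * τ ^ 2) ≤
      (σ + 2 * τ) / (2 * σ * τ ^ 2) * (σ - τ) ^ 2 := by
  have hlog := Real.log_le_sub_one_of_pos (div_pos hτ hσ)
  rw [Real.log_div hτ.ne' hσ.ne'] at hlog
  have heq : τ / σ - 1 - 1 / 2 + σ ^ 2 / (2 * τ ^ 2) =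
      (σ + 2 * τ) / (2 * σ * τ ^ 2) * (σ - τ) ^ 2 := by
    field_simp
    ring
  linarith

/-- Quadratic perturbation bound for the Gaussian KL divergence: for
`0 < σ_min < σ_max` there is a constant `C₀ > 0` depending only on `σ_min, σ_max`
such that for all means and all standard deviations in `[σ_min, σ_max]`,
`D_KL(N(μ,σ²) ‖ N(μ̃,σ̃²)) ≤ C₀((μ − μ̃)² + (σ − σ̃)²)`. -/
theorem gaussian_klDiv_quadratic_bound (σmin σmax : ℝ) (h0 : 0 < σmin) (h1 : σmin < σmax) :
    ∃ C₀ : ℝ, 0 < C₀ ∧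
      ∀ μ μt σ σt : ℝ, σ ∈ Set.Icc σmin σmax → σt ∈ Set.Icc σmin σmax →
        klDiv (gaussian μ σ) (gaussian μt σt)
          ≤ ((C₀ * ((μ - μt) ^ 2 + (σ - σt) ^ 2) : ℝ) : EReal) := by
  refine ⟨3 * σmax / (2 * σmin ^ 3), by have := h0.trans h1; positivity, ?_⟩
  rintro μ μt σ σt ⟨hσ, hσ'⟩ ⟨hσt, hσt'⟩
  have hσ0 : 0 < σ := h0.trans_le hσ
  have hσt0 : 0 < σt := h0.trans_le hσt
  have hM : 0 < σmax := h0.trans h1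
  rw [gaussian, gaussian, klDiv_gaussianReal _ _ (Real.toNNReal_pos.2 (by positivity)).ne'
    (Real.toNNReal_pos.2 (by positivity)).ne', Real.coe_toNNReal _ (sq_nonneg σ),
    Real.coe_toNNReal _ (sq_nonneg σt), EReal.coe_le_coe_iff, Real.log_pow, Real.log_pow]
  have hvar := log_sub_log_add_sq_div_le hσ0 hσt0
  have hcoef : (σ + 2 * σt) / (2 * σ * σt ^ 2) ≤ 3 * σmax / (2 * σmin ^ 3) := by
    apply div_le_div₀ (by positivity) (by linarith) (by positivity)
    calc 2 * σmin ^ 3 = 2 * σmin * σmin ^ 2 := by ring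
      _ ≤ 2 * σ * σt ^ 2 := by gcongr
  have hcoef' : 1 / (2 * σt ^ 2) ≤ 3 * σmax / (2 * σmin ^ 3) := by
    calc 1 / (2 * σt ^ 2) ≤ 1 / (2 * σmin ^ 2) := by gcongr
      _ = σmin / (2 * σmin ^ 3) := by field_simp
      _ ≤ 3 * σmax / (2 * σmin ^ 3) := by gcongr; linarith
  have hvar' := hvar.trans (mul_le_mul_of_nonneg_right hcoef (sq_nonneg (σ - σt)))
  have hmean := mul_le_mul_of_nonneg_right hcoef' (sq_nonneg (μ - μt))
  calc _ = 1 / (2 * σt ^ 2) * (μ - μt) ^ 2 +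
        (Real.log σt - Real.log σ - 1 / 2 + σ ^ 2 / (2 * σt ^ 2)) := by push_cast; ring
    _ ≤ _ := by rw [mul_add]; exact add_le_add hmean hvar'
end

section
/- Let K be a positive integer and fix constants ε ∈ (0, 1/2) and 0 < σ_min < σ_max < ∞. Then there exists a constant C_KL > 0, depending only on ε, σ_min, σ_max, with the following property. Let f = ∑_{k<K} π_k N(μ_k, σ_k²) and f̃ = ∑_{k<K} π̃_k N(μ̃_k, σ̃_k²) be K-component Gaussian mixtures whose weights satisfy π_k, π̃_k ∈ [ε, 1−ε] with ∑_k π_k = ∑_k π̃_k = 1 and whose standard deviations satisfy σ_k, σ̃_k ∈ [σ_min, σ_max]. Let ε_par = max_k max{ |π_k − π̃_k|, |μ_k − μ̃_k|, |σ_k − σ̃_k| }. Then D_KL(f ‖ f̃) ≤ C_KL · K · ε_par². -/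
open MeasureTheory ProbabilityTheory
open scoped Classical

/-- A `K`-component Gaussian mixture with weights `w`, means `μ`, standard deviations `σ`. -/
noncomputable def mixture (K : ℕ) (w μ σ : ℕ → ℝ) : Measure ℝ :=
  ∑ k ∈ Finset.range K, ENNReal.ofReal (w k) • gaussian (μ k) (σ k)

/-- The log-sum inequality. -/
lemma sum_mul_log_div_sum_le {ι : Type*} {s : Finset ι} (hs : s.Nonempty) {a b : ι → ℝ}
    (ha : ∀ i ∈ s, 0 < a i) (hb : ∀ i ∈ s, 0 < b i) :
    (∑ i ∈ s, a i) * Real.log ((∑ i ∈ s, a i) / ∑ i ∈ s, b i)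
      ≤ ∑ i ∈ s, a i * Real.log (a i / b i) := by
  have hA : 0 < ∑ i ∈ s, a i := Finset.sum_pos ha hs
  have hB : 0 < ∑ i ∈ s, b i := Finset.sum_pos hb hs
  set A := ∑ i ∈ s, a i with hAdef
  set B := ∑ i ∈ s, b i with hBdef
  have key : ∀ i ∈ s, a i * Real.log (A / B) - a i * Real.log (a i / b i) ≤
      A / B * b i - a i := by
    intro i hi
    have hai := ha i hi
    have hbi := hb i hi
    have h := Real.log_le_sub_one_of_pos (x := (A / B) / (a i / b i)) (by positivity)
    rw [Real.log_div (by positivity) (by positivity)] at h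
    have h' := mul_le_mul_of_nonneg_left h hai.le
    have e : a i * (A / B / (a i / b i) - 1) = A / B * b i - a i := by field_simp
    linarith
  have h := Finset.sum_le_sum key
  rw [Finset.sum_sub_distrib, Finset.sum_sub_distrib, ← Finset.sum_mul, ← Finset.mul_sum,
    ← hAdef, ← hBdef, div_mul_cancel₀ _ hB.ne'] at h
  linarith

lemma abs_log_div_sum_le {ι : Type*} {s : Finset ι} (hs : s.Nonempty) {a b : ι → ℝ}
    (ha : ∀ i ∈ s, 0 < a i) (hb : ∀ i ∈ s, 0 < b i) :
    |Real.log ((∑ i ∈ s, a i) / ∑ i ∈ s, b i)| ≤ ∑ i ∈ s, |Real.log (a i / b i)| := by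
  have hA : 0 < ∑ i ∈ s, a i := Finset.sum_pos ha hs
  have hB : 0 < ∑ i ∈ s, b i := Finset.sum_pos hb hs
  set M := ∑ i ∈ s, |Real.log (a i / b i)| with hM
  have hle : ∀ i ∈ s, |Real.log (a i / b i)| ≤ M := fun i hi =>
    Finset.single_le_sum (f := fun i => |Real.log (a i / b i)|) (fun _ _ => abs_nonneg _) hi
  have h1 : ∑ i ∈ s, a i ≤ Real.exp M * ∑ i ∈ s, b i := by
    rw [Finset.mul_sum]
    refine Finset.sum_le_sum fun i hi => ?_
    rw [← div_le_iff₀ (hb i hi), ← Real.log_le_iff_le_exp (div_pos (ha i hi) (hb i hi))]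
    exact (le_abs_self _).trans (hle i hi)
  have h2 : Real.exp (-M) * ∑ i ∈ s, b i ≤ ∑ i ∈ s, a i := by
    rw [Finset.mul_sum]
    refine Finset.sum_le_sum fun i hi => ?_
    rw [← le_div_iff₀ (hb i hi), ← Real.le_log_iff_exp_le (div_pos (ha i hi) (hb i hi))]
    exact neg_le_of_abs_le (hle i hi)
  rw [abs_le]
  constructor
  · rwa [Real.le_log_iff_exp_le (div_pos hA hB), le_div_iff₀ hB]
  · rwa [Real.log_le_iff_le_exp (div_pos hA hB), div_le_iff₀ hB]

/-- Divergence of two measures whose densities are sums of positive functions, bounded by means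
of the log-sum inequality. -/
lemma klDiv_withDensity_sum_le {α ι : Type*} [MeasurableSpace α] (ν : Measure α) [SigmaFinite ν]
    {s : Finset ι} (hs : s.Nonempty) {a b : ι → α → ℝ}
    (ha : ∀ i ∈ s, ∀ x, 0 < a i x) (hb : ∀ i ∈ s, ∀ x, 0 < b i x)
    (ham : ∀ i ∈ s, Measurable (a i)) (hbm : ∀ i ∈ s, Measurable (b i))
    (hint : ∀ i ∈ s, ∀ j ∈ s, Integrable (fun x => a i x * Real.log (a j x / b j x)) ν) :
    klDiv (ν.withDensity fun x => ENNReal.ofReal (∑ i ∈ s, a i x))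
        (ν.withDensity fun x => ENNReal.ofReal (∑ i ∈ s, b i x))
      ≤ ((∑ i ∈ s, ∫ x, a i x * Real.log (a i x / b i x) ∂ν : ℝ) : EReal) := by
  set p : α → ℝ := fun x => ∑ i ∈ s, a i x with hp
  set q : α → ℝ := fun x => ∑ i ∈ s, b i x with hq
  have hp0 : ∀ x, 0 < p x := fun x => Finset.sum_pos (fun i hi => ha i hi x) hs
  have hq0 : ∀ x, 0 < q x := fun x => Finset.sum_pos (fun i hi => hb i hi x) hs
  have hpm : Measurable p := Finset.measurable_fun_sum s ham
  have hqm : Measurable q := Finset.measurable_fun_sum s hbm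
  set P := ν.withDensity fun x => ENNReal.ofReal (p x)
  set Q := ν.withDensity fun x => ENNReal.ofReal (q x)
  have : SigmaFinite Q := SigmaFinite.withDensity_ofReal _
  have hPQ : P = Q.withDensity fun x => ENNReal.ofReal (p x / q x) := by
    have hr : Measurable fun x => ENNReal.ofReal (p x / q x) := (hpm.div hqm).ennreal_ofReal
    rw [← withDensity_mul _ hqm.ennreal_ofReal hr]
    refine congrArg ν.withDensity (funext fun x => ?_)
    rw [Pi.mul_apply, ← ENNReal.ofReal_mul (hq0 x).le, mul_div_cancel₀ _ (hq0 x).ne']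
  have hac : P ≪ Q := hPQ ▸ withDensity_absolutelyContinuous _ _
  have hrn : (fun x => Real.log (P.rnDeriv Q x).toReal) =ᵐ[P] fun x => Real.log (p x / q x) := by
    have h := hac.ae_le (Measure.rnDeriv_withDensity Q
      (f := fun x => ENNReal.ofReal (p x / q x)) (hpm.div hqm).ennreal_ofReal)
    rw [← hPQ] at h
    filter_upwards [h] with x hx
    rw [hx, ENNReal.toReal_ofReal (div_pos (hp0 x) (hq0 x)).le]
  have htop : ∀ᵐ x ∂ν, ENNReal.ofReal (p x) < ⊤ := ae_of_all _ fun _ => ENNReal.ofReal_lt_top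
  have hI : Integrable (fun x => p x * Real.log (p x / q x)) ν := by
    refine Integrable.mono' (g := fun x => ∑ i ∈ s, ∑ j ∈ s, |a i x * Real.log (a j x / b j x)|)
      (integrable_finsetSum _ fun i hi => integrable_finsetSum _ fun j hj => (hint i hi j hj).abs)
      (by fun_prop) (ae_of_all _ fun x => ?_)
    have h := mul_le_mul_of_nonneg_left (abs_log_div_sum_le hs (a := fun i => a i x)
      (b := fun i => b i x) (fun i hi => ha i hi x) (fun i hi => hb i hi x)) (hp0 x).le
    rw [Real.norm_eq_abs, abs_mul, abs_of_pos (hp0 x)]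
    refine h.trans_eq ?_
    rw [hp, Finset.sum_mul]
    refine Finset.sum_congr rfl fun i hi => ?_
    rw [Finset.mul_sum]
    exact Finset.sum_congr rfl fun j _ => by rw [abs_mul, abs_of_pos (ha i hi x)]
  have hIP : Integrable (fun x => Real.log (p x / q x)) P := by
    rw [integrable_withDensity_iff_integrable_smul' hpm.ennreal_ofReal htop]
    refine hI.congr (ae_of_all _ fun x => ?_)
    simp only [ENNReal.toReal_ofReal (hp0 x).le, smul_eq_mul]
  rw [klDiv, if_pos ⟨hac, hIP.congr hrn.symm⟩, EReal.coe_le_coe_iff, integral_congr_ae hrn,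
    integral_withDensity_eq_integral_toReal_smul hpm.ennreal_ofReal htop,
    ← integral_finsetSum _ fun i hi => hint i hi i hi]
  refine integral_mono (hI.congr (ae_of_all _ fun x => ?_))
    (integrable_finsetSum _ fun i hi => hint i hi i hi) fun x => ?_
  · simp only [ENNReal.toReal_ofReal (hp0 x).le, smul_eq_mul]
  · simp only [ENNReal.toReal_ofReal (hp0 x).le, smul_eq_mul]
    exact sum_mul_log_div_sum_le hs (fun i hi => ha i hi x) (fun i hi => hb i hi x)

/-- The mixture has the weighted sum of the Gaussian densities as its Lebesgue density. -/
lemma mixture_eq_withDensity (K : ℕ) {w μ σ : ℕ → ℝ} (hw : ∀ k < K, 0 ≤ w k)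
    (hσ : ∀ k < K, 0 < σ k) :
    mixture K w μ σ = volume.withDensity fun x =>
      ENNReal.ofReal (∑ k ∈ Finset.range K, w k * gaussianPDFReal (μ k) (σ k ^ 2).toNNReal x) := by
  ext t ht
  have e : ∀ x, ENNReal.ofReal
      (∑ k ∈ Finset.range K, w k * gaussianPDFReal (μ k) (σ k ^ 2).toNNReal x) =
      ∑ k ∈ Finset.range K,
        ENNReal.ofReal (w k) * gaussianPDF (μ k) (σ k ^ 2).toNNReal x := by
    intro x
    rw [ENNReal.ofReal_sum_of_nonneg fun k hk => mul_nonneg (hw k (Finset.mem_range.1 hk))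
      (gaussianPDFReal_nonneg _ _ _)]
    exact Finset.sum_congr rfl fun k hk => ENNReal.ofReal_mul (hw k (Finset.mem_range.1 hk))
  rw [withDensity_apply _ ht]
  simp_rw [e]
  rw [lintegral_finsetSum _ fun k _ => (measurable_gaussianPDF _ _).const_mul _, mixture,
    Measure.finsetSum_apply]
  refine Finset.sum_congr rfl fun k hk => ?_
  have h0 : (σ k ^ 2).toNNReal ≠ 0 :=
    (Real.toNNReal_pos.2 (pow_pos (hσ k (Finset.mem_range.1 hk)) 2)).ne'
  rw [lintegral_const_mul _ (measurable_gaussianPDF _ _), Measure.smul_apply, gaussian,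
    gaussianReal_apply _ h0, smul_eq_mul]

lemma integrable_gaussian_sub_sq (m μ σ : ℝ) :
    Integrable (fun x => (x - m) ^ 2) (gaussian μ σ) := by
  have h : MemLp (fun x : ℝ => x - m) 2 (gaussianReal μ (σ ^ 2).toNNReal) :=
    (memLp_id_gaussianReal 2).sub (memLp_const m)
  exact h.integrable_sq

lemma integral_gaussian_sub_sq (m μ σ : ℝ) :
    ∫ x, (x - m) ^ 2 ∂(gaussian μ σ) = σ ^ 2 + (μ - m) ^ 2 := by
  have hv := variance_fun_id_gaussianReal (μ := μ) (v := (σ ^ 2).toNNReal)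
  rw [variance_eq_integral measurable_id'.aemeasurable] at hv
  simp only [integral_id_gaussianReal, Real.coe_toNNReal _ (sq_nonneg σ)] at hv
  have hid : Integrable (fun x : ℝ => x) (gaussianReal μ (σ ^ 2).toNNReal) :=
    (memLp_id_gaussianReal 1).integrable le_rfl
  have hsq := integrable_gaussian_sub_sq μ μ σ
  unfold gaussian at hsq ⊢
  have e : ∀ x : ℝ, (x - m) ^ 2 = (x - μ) ^ 2 + (2 * (μ - m) * x + (m ^ 2 - μ ^ 2)) := by
    intro x; ring
  have hlin : Integrable (fun x : ℝ => 2 * (μ - m) * x + (m ^ 2 - μ ^ 2))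
      (gaussianReal μ (σ ^ 2).toNNReal) := (hid.const_mul _).add (integrable_const _)
  rw [integral_congr_ae (ae_of_all _ e), integral_add hsq hlin,
    integral_add (hid.const_mul _) (integrable_const _), hv, integral_const_mul,
    integral_id_gaussianReal]
  simp
  ring

lemma integrable_gaussian_quadratic (c A B m n μ σ : ℝ) :
    Integrable (fun x => c + (A * (x - m) ^ 2 - B * (x - n) ^ 2)) (gaussian μ σ) := by
  have : IsProbabilityMeasure (gaussian μ σ) := by unfold gaussian; infer_instance
  exact (integrable_const c).add (((integrable_gaussian_sub_sq m μ σ).const_mul A).sub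
    ((integrable_gaussian_sub_sq n μ σ).const_mul B))

lemma integral_gaussian_quadratic (c A B m n μ σ : ℝ) :
    ∫ x, (c + (A * (x - m) ^ 2 - B * (x - n) ^ 2)) ∂(gaussian μ σ) =
      c + (A * (σ ^ 2 + (μ - m) ^ 2) - B * (σ ^ 2 + (μ - n) ^ 2)) := by
  have : IsProbabilityMeasure (gaussian μ σ) := by unfold gaussian; infer_instance
  have hm := (integrable_gaussian_sub_sq m μ σ).const_mul A
  have hn := (integrable_gaussian_sub_sq n μ σ).const_mul B
  have hmn : Integrable (fun x => A * (x - m) ^ 2 - B * (x - n) ^ 2) (gaussian μ σ) := hm.sub hn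
  rw [integral_add (integrable_const c) hmn, integral_sub hm hn, integral_const_mul,
    integral_const_mul, integral_gaussian_sub_sq, integral_gaussian_sub_sq]
  simp

lemma log_mul_gaussianPDFReal_div {w wt σ σt : ℝ} (hw : 0 < w) (hwt : 0 < wt) (hσ : 0 < σ)
    (hσt : 0 < σt) (μ μt x : ℝ) :
    Real.log (w * gaussianPDFReal μ (σ ^ 2).toNNReal x /
        (wt * gaussianPDFReal μt (σt ^ 2).toNNReal x)) =
      Real.log (w / wt) + Real.log (σt / σ) +
        ((2 * σt ^ 2)⁻¹ * (x - μt) ^ 2 - (2 * σ ^ 2)⁻¹ * (x - μ) ^ 2) := by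
  have e : w * gaussianPDFReal μ (σ ^ 2).toNNReal x /
        (wt * gaussianPDFReal μt (σt ^ 2).toNNReal x) =
      w / wt * (σt / σ) *
        Real.exp ((2 * σt ^ 2)⁻¹ * (x - μt) ^ 2 - (2 * σ ^ 2)⁻¹ * (x - μ) ^ 2) := by
    have hs : ∀ τ : ℝ, 0 < τ → √(2 * Real.pi * τ ^ 2) = √(2 * Real.pi) * τ := fun τ hτ => by
      rw [Real.sqrt_mul (by positivity), Real.sqrt_sq hτ.le]
    have hx : (2 * σt ^ 2)⁻¹ * (x - μt) ^ 2 - (2 * σ ^ 2)⁻¹ * (x - μ) ^ 2 =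
        -(x - μ) ^ 2 / (2 * σ ^ 2) - -(x - μt) ^ 2 / (2 * σt ^ 2) := by
      field_simp
      ring
    rw [hx, Real.exp_sub]
    simp only [gaussianPDFReal, Real.coe_toNNReal _ (sq_nonneg _), hs σ hσ, hs σt hσt]
    field_simp
  rw [e, Real.log_mul (by positivity) (by positivity), Real.log_mul (by positivity) (by positivity),
    Real.log_exp]

/-- The Kullback–Leibler divergence between two Gaussians is at most quadratic in the
perturbation of the parameters. -/
lemma gaussian_divergence_le {σmin σmax σ σt μ μt e : ℝ} (h0 : 0 < σmin)
    (hσ : σ ∈ Set.Icc σmin σmax) (hσt : σt ∈ Set.Icc σmin σmax)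
    (hμe : |μ - μt| ≤ e) (hσe : |σ - σt| ≤ e) :
    Real.log (σt / σ) + ((2 * σt ^ 2)⁻¹ * (σ ^ 2 + (μ - μt) ^ 2) - (2 * σ ^ 2)⁻¹ * σ ^ 2)
      ≤ (1 + σmax / σmin) / σmin ^ 2 * e ^ 2 := by
  have hs : 0 < σ := h0.trans_le hσ.1
  have hst : 0 < σt := h0.trans_le hσt.1
  have hlog := Real.log_le_sub_one_of_pos (div_pos hst hs)
  have hm : (μ - μt) ^ 2 ≤ e ^ 2 := sq_le_sq' (neg_le_of_abs_le hμe) (le_of_abs_le hμe)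
  have hd : (σ - σt) ^ 2 ≤ e ^ 2 := sq_le_sq' (neg_le_of_abs_le hσe) (le_of_abs_le hσe)
  have hratio : σt / σ ≤ σmax / σmin := div_le_div₀ (hst.le.trans hσt.2) hσt.2 h0 hσ.1
  have hinv : (σt ^ 2)⁻¹ ≤ (σmin ^ 2)⁻¹ :=
    inv_anti₀ (by positivity) (pow_le_pow_left₀ h0.le hσt.1 2)
  have hr0 : 0 < σmax / σmin := (div_pos hst hs).trans_le hratio
  calc _ ≤ σt / σ - 1 +
        ((2 * σt ^ 2)⁻¹ * (σ ^ 2 + (μ - μt) ^ 2) - (2 * σ ^ 2)⁻¹ * σ ^ 2) := by linarith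
    _ = (σt ^ 2)⁻¹ * ((1 / 2 + σt / σ) * (σ - σt) ^ 2 + 1 / 2 * (μ - μt) ^ 2) := by
      field_simp
      ring
    _ ≤ (σmin ^ 2)⁻¹ * ((1 / 2 + σmax / σmin) * e ^ 2 + 1 / 2 * e ^ 2) := by gcongr
    _ = _ := by ring

lemma sum_mul_log_div_le_sum_sq_div {ι : Type*} {s : Finset ι} {w wt : ι → ℝ}
    (hw : ∀ i ∈ s, 0 < w i) (hwt : ∀ i ∈ s, 0 < wt i) (hsum : ∑ i ∈ s, w i = ∑ i ∈ s, wt i) :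
    ∑ i ∈ s, w i * Real.log (w i / wt i) ≤ ∑ i ∈ s, (w i - wt i) ^ 2 / wt i := by
  have h : ∀ i ∈ s, w i * Real.log (w i / wt i) ≤ (w i - wt i) ^ 2 / wt i + (w i - wt i) := by
    intro i hi
    have hwi := hw i hi
    have hwti := hwt i hi
    refine (mul_le_mul_of_nonneg_left
      (Real.log_le_sub_one_of_pos (div_pos hwi hwti)) hwi.le).trans_eq ?_
    field_simp
    ring
  refine (Finset.sum_le_sum h).trans_eq ?_
  rw [Finset.sum_add_distrib, Finset.sum_sub_distrib, hsum, sub_self, add_zero]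

lemma klDiv_mixture_le {K : ℕ} (hK : 0 < K) {w wt μ μt σ σt : ℕ → ℝ}
    (hw0 : ∀ k ∈ Finset.range K, 0 < w k) (hwt0 : ∀ k ∈ Finset.range K, 0 < wt k)
    (hσ0 : ∀ k ∈ Finset.range K, 0 < σ k) (hσt0 : ∀ k ∈ Finset.range K, 0 < σt k) :
    klDiv (mixture K w μ σ) (mixture K wt μt σt) ≤
      ((∑ k ∈ Finset.range K, (w k * Real.log (w k / wt k) +
        w k * (Real.log (σt k / σ k) + ((2 * σt k ^ 2)⁻¹ * (σ k ^ 2 + (μ k - μt k) ^ 2) -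
          (2 * σ k ^ 2)⁻¹ * σ k ^ 2))) : ℝ) : EReal) := by
  have hs : (Finset.range K).Nonempty := Finset.nonempty_range_iff.mpr hK.ne'
  have hvar : ∀ τ : ℝ, 0 < τ → (τ ^ 2).toNNReal ≠ 0 := fun τ hτ =>
    (Real.toNNReal_pos.2 (pow_pos hτ 2)).ne'
  set L : ℕ → ℝ → ℝ := fun k x => Real.log (w k / wt k) + Real.log (σt k / σ k) +
    ((2 * σt k ^ 2)⁻¹ * (x - μt k) ^ 2 - (2 * σ k ^ 2)⁻¹ * (x - μ k) ^ 2) with hL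
  have hlog : ∀ k ∈ Finset.range K, ∀ x,
      Real.log (w k * gaussianPDFReal (μ k) (σ k ^ 2).toNNReal x /
        (wt k * gaussianPDFReal (μt k) (σt k ^ 2).toNNReal x)) = L k x := fun k hk x =>
    log_mul_gaussianPDFReal_div (hw0 k hk) (hwt0 k hk) (hσ0 k hk) (hσt0 k hk) _ _ _
  have hLint : ∀ i j, Integrable (L j) (gaussian (μ i) (σ i)) := fun i j =>
    integrable_gaussian_quadratic _ _ _ _ _ _ _
  have hint : ∀ i ∈ Finset.range K, ∀ j ∈ Finset.range K, Integrable (fun x =>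
      w i * gaussianPDFReal (μ i) (σ i ^ 2).toNNReal x *
        Real.log (w j * gaussianPDFReal (μ j) (σ j ^ 2).toNNReal x /
          (wt j * gaussianPDFReal (μt j) (σt j ^ 2).toNNReal x))) volume := by
    intro i hi j hj
    have h := hLint i j
    rw [gaussian, gaussianReal_of_var_ne_zero _ (hvar _ (hσ0 i hi)),
      integrable_withDensity_iff_integrable_smul' (measurable_gaussianPDF _ _)
        (ae_of_all _ fun _ => gaussianPDF_lt_top)] at h
    refine (h.const_mul (w i)).congr (ae_of_all _ fun x => ?_)
    simp only [toReal_gaussianPDF, smul_eq_mul, hlog j hj x, mul_assoc]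
  rw [mixture_eq_withDensity K (fun k hk => (hw0 k (Finset.mem_range.2 hk)).le)
      fun k hk => hσ0 k (Finset.mem_range.2 hk),
    mixture_eq_withDensity K (fun k hk => (hwt0 k (Finset.mem_range.2 hk)).le)
      fun k hk => hσt0 k (Finset.mem_range.2 hk)]
  refine (klDiv_withDensity_sum_le volume hs
    (a := fun k x => w k * gaussianPDFReal (μ k) (σ k ^ 2).toNNReal x)
    (b := fun k x => wt k * gaussianPDFReal (μt k) (σt k ^ 2).toNNReal x)
    (fun k hk x => mul_pos (hw0 k hk) (gaussianPDFReal_pos _ _ x (hvar _ (hσ0 k hk))))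
    (fun k hk x => mul_pos (hwt0 k hk) (gaussianPDFReal_pos _ _ x (hvar _ (hσt0 k hk))))
    (fun k _ => (measurable_gaussianPDFReal _ _).const_mul _)
    (fun k _ => (measurable_gaussianPDFReal _ _).const_mul _) hint).trans ?_
  rw [EReal.coe_le_coe_iff]
  refine (Finset.sum_congr rfl fun k hk => ?_).le
  have hLk := integral_gaussian_quadratic (Real.log (w k / wt k) + Real.log (σt k / σ k))
    (2 * σt k ^ 2)⁻¹ (2 * σ k ^ 2)⁻¹ (μt k) (μ k) (μ k) (σ k)
  have h := integral_gaussianReal_eq_integral_smul (μ := μ k) (f := L k) (hvar _ (hσ0 k hk))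
  rw [gaussian, h] at hLk
  calc _ = ∫ x, w k * (gaussianPDFReal (μ k) (σ k ^ 2).toNNReal x • L k x) :=
        integral_congr_ae (ae_of_all _ fun x => by simp only [hlog k hk x, smul_eq_mul, mul_assoc])
    _ = _ := by
      rw [integral_const_mul, hLk]
      ring

/-- Lemma 3 (sup-norm parameter perturbation implies KL control): for fixed
`ε ∈ (0,1/2)` and `0 < σ_min < σ_max` there is a constant `C_KL > 0` depending only on
`ε, σ_min, σ_max` such that for any two `K`-component Gaussian mixtures with weights in
`[ε, 1−ε]` summing to one and standard deviations in `[σ_min, σ_max]`,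
`D_KL(f ‖ f̃) ≤ C_KL · K · ε_par²`, where
`ε_par = max_k max{|π_k − π̃_k|, |μ_k − μ̃_k|, |σ_k − σ̃_k|}`. -/
theorem mixture_param_perturbation_kl
    (ε σmin σmax : ℝ) (hε : ε ∈ Set.Ioo (0 : ℝ) (1 / 2)) (h0 : 0 < σmin) (h1 : σmin < σmax) :
    ∃ C : ℝ, 0 < C ∧
      ∀ (K : ℕ) (hK : 0 < K) (w wt μ μt σ σt : ℕ → ℝ),
        (∀ k < K, w k ∈ Set.Icc ε (1 - ε)) → (∀ k < K, wt k ∈ Set.Icc ε (1 - ε)) →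
        (∑ k ∈ Finset.range K, w k = 1) → (∑ k ∈ Finset.range K, wt k = 1) →
        (∀ k < K, σ k ∈ Set.Icc σmin σmax) → (∀ k < K, σt k ∈ Set.Icc σmin σmax) →
        klDiv (mixture K w μ σ) (mixture K wt μt σt)
          ≤ ((C * K *
              ((Finset.range K).sup' (Finset.nonempty_range_iff.mpr hK.ne')
                (fun k => max |w k - wt k| (max |μ k - μt k| |σ k - σt k|))) ^ 2 : ℝ)
            : EReal) := by
  have hε0 : 0 < ε := hε.1
  have hσmax : 0 < σmax := h0.trans h1
  refine ⟨1 / ε + (1 + σmax / σmin) / σmin ^ 2, by positivity, ?_⟩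
  intro K hK w wt μ μt σ σt hw hwt hsw hswt hσ hσt
  set c := (1 + σmax / σmin) / σmin ^ 2 with hc
  have hc0 : 0 < c := by positivity
  set e := (Finset.range K).sup' (Finset.nonempty_range_iff.mpr hK.ne')
    (fun k => max |w k - wt k| (max |μ k - μt k| |σ k - σt k|)) with he
  have hle : ∀ k ∈ Finset.range K, max |w k - wt k| (max |μ k - μt k| |σ k - σt k|) ≤ e :=
    fun k hk => Finset.le_sup' (fun k => max |w k - wt k| (max |μ k - μt k| |σ k - σt k|)) hk
  have hw0 : ∀ k ∈ Finset.range K, 0 < w k := fun k hk =>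
    hε0.trans_le (hw k (Finset.mem_range.1 hk)).1
  have hwt0 : ∀ k ∈ Finset.range K, 0 < wt k := fun k hk =>
    hε0.trans_le (hwt k (Finset.mem_range.1 hk)).1
  have hσ0 : ∀ k ∈ Finset.range K, 0 < σ k := fun k hk =>
    h0.trans_le (hσ k (Finset.mem_range.1 hk)).1
  have hσt0 : ∀ k ∈ Finset.range K, 0 < σt k := fun k hk =>
    h0.trans_le (hσt k (Finset.mem_range.1 hk)).1
  refine (klDiv_mixture_le hK hw0 hwt0 hσ0 hσt0).trans ?_
  rw [EReal.coe_le_coe_iff]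
  have hterm : ∀ k ∈ Finset.range K, w k * Real.log (w k / wt k) +
      w k * (Real.log (σt k / σ k) + ((2 * σt k ^ 2)⁻¹ * (σ k ^ 2 + (μ k - μt k) ^ 2) -
        (2 * σ k ^ 2)⁻¹ * σ k ^ 2)) ≤
      w k * Real.log (w k / wt k) + w k * (c * e ^ 2) := by
    intro k hk
    have hmax := hle k hk
    simp only [max_le_iff] at hmax
    have hg := gaussian_divergence_le h0 (hσ k (Finset.mem_range.1 hk))
      (hσt k (Finset.mem_range.1 hk)) hmax.2.1 hmax.2.2
    linarith [mul_le_mul_of_nonneg_left hg (hw0 k hk).le]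
  have hweights : ∑ k ∈ Finset.range K, w k * Real.log (w k / wt k) ≤ K * (1 / ε * e ^ 2) := by
    refine (sum_mul_log_div_le_sum_sq_div hw0 hwt0 (hsw.trans hswt.symm)).trans ?_
    calc _ ≤ ∑ k ∈ Finset.range K, 1 / ε * e ^ 2 := Finset.sum_le_sum fun k hk => by
          have hk' : |w k - wt k| ≤ e := (le_max_left _ _).trans (hle k hk)
          rw [one_div_mul_eq_div]
          exact div_le_div₀ (sq_nonneg _)
            (sq_le_sq' (neg_le_of_abs_le hk') (le_of_abs_le hk')) hε0
            (hwt k (Finset.mem_range.1 hk)).1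
      _ = _ := by simp
  have hK1 : (1 : ℝ) ≤ K := by exact_mod_cast hK
  have hce : c * e ^ 2 ≤ K * (c * e ^ 2) := le_mul_of_one_le_left (by positivity) hK1
  refine (Finset.sum_le_sum hterm).trans ?_
  rw [Finset.sum_add_distrib, ← Finset.sum_mul, hsw]
  linarith
end

section
/- Let s ∈ (0, 1], L > 0, and let g : ℝ → ℝ satisfy the Hölder condition |g(x) − g(y)| ≤ L·|x − y|^s for all x, y ∈ [0, 1]. Then for every positive integer n there exists a continuous function h : ℝ → ℝ that is affine on each interval [k/n, (k+1)/n] for k = 0, …, n−1 (i.e., for each such k there exist a, b ∈ ℝ with h(x) = a·x + b for all x ∈ [k/n, (k+1)/n]), such that sup_{x ∈ [0,1]} |g(x) − h(x)| ≤ 2·L·n^{−s}. -/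
/-- The continuous function that interpolates `v` linearly between the integers `0, …, n` and is
constant outside `[0, n]`. -/
noncomputable def linearInterpolant (v : ℕ → ℝ) (n : ℕ) (t : ℝ) : ℝ :=
  v 0 + ∑ j ∈ Finset.range n, (v (j + 1) - v j) * max 0 (min 1 (t - j))

theorem continuous_linearInterpolant (v : ℕ → ℝ) (n : ℕ) :
    Continuous (linearInterpolant v n) := by
  unfold linearInterpolant
  fun_prop

theorem linearInterpolant_eq (v : ℕ → ℝ) {n k : ℕ} (hk : k < n) {t : ℝ}
    (h₀ : (k : ℝ) ≤ t) (h₁ : t ≤ k + 1) :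
    linearInterpolant v n t = v k + (v (k + 1) - v k) * (t - k) := by
  unfold linearInterpolant
  induction n, (show k + 1 ≤ n from hk) using Nat.le_induction with
  | base =>
    have hsum : ∑ j ∈ Finset.range k, (v (j + 1) - v j) * max 0 (min 1 (t - j)) = v k - v 0 := by
      rw [← Finset.sum_range_sub]
      refine Finset.sum_congr rfl fun j hj => ?_
      have hjk : (j : ℝ) + 1 ≤ k := by exact_mod_cast Finset.mem_range.mp hj
      rw [min_eq_left (by linarith), max_eq_right zero_le_one, mul_one]
    rw [Finset.sum_range_succ, hsum, min_eq_right (by linarith), max_eq_right (by linarith)]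
    ring
  | succ m hm ih =>
    have hkm : (k : ℝ) + 1 ≤ m := by exact_mod_cast hm
    rw [Finset.sum_range_succ, max_eq_left ((min_le_right _ _).trans (by linarith)), mul_zero,
      add_zero]
    exact ih hm

theorem abs_sub_lineMap_le {y a b θ C : ℝ} (h₀ : 0 ≤ θ) (h₁ : θ ≤ 1)
    (ha : |y - a| ≤ C) (hb : |y - b| ≤ C) : |y - (a + (b - a) * θ)| ≤ C := by
  rw [abs_le] at *
  constructor <;> nlinarith

theorem exists_nat_lt_le_le_add_one {n : ℕ} (hn : 0 < n) {t : ℝ} (h₀ : 0 ≤ t) (h₁ : t ≤ n) :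
    ∃ k < n, (k : ℝ) ≤ t ∧ t ≤ k + 1 := by
  rcases h₁.eq_or_lt with rfl | h₁
  · refine ⟨n - 1, by omega, ?_, ?_⟩ <;> rw [Nat.cast_pred hn] <;> linarith
  · exact ⟨⌊t⌋₊, (Nat.floor_lt h₀).mpr h₁, Nat.floor_le h₀, (Nat.lt_floor_add_one t).le⟩

/-- One-dimensional ReLU (continuous piecewise-affine) approximation of Hölder functions:
if `g` is `s`-Hölder on `[0,1]` with constant `L`, then for every `n ≥ 1` there is a
continuous function `h` that is affine on each interval `[k/n, (k+1)/n]`, `k = 0, …, n−1`,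
with `sup_{x ∈ [0,1]} |g(x) − h(x)| ≤ 2 L n^{−s}`. -/
theorem holder_piecewise_affine_approx
    (s L : ℝ) (hs0 : 0 < s) (hs1 : s ≤ 1) (hL : 0 < L)
    (g : ℝ → ℝ)
    (hg : ∀ x ∈ Set.Icc (0 : ℝ) 1, ∀ y ∈ Set.Icc (0 : ℝ) 1, |g x - g y| ≤ L * |x - y| ^ s)
    (n : ℕ) (hn : 0 < n) :
    ∃ h : ℝ → ℝ, Continuous h ∧
      (∀ k < n, ∃ a b : ℝ,
        ∀ x ∈ Set.Icc ((k : ℝ) / n) (((k : ℝ) + 1) / n), h x = a * x + b) ∧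
      ∀ x ∈ Set.Icc (0 : ℝ) 1, |g x - h x| ≤ 2 * L * (n : ℝ) ^ (-s) := by
  have hn' : (0 : ℝ) < n := by exact_mod_cast hn
  refine ⟨fun x => linearInterpolant (fun j => g (j / n)) n (n * x),
    (continuous_linearInterpolant _ n).comp (continuous_const.mul continuous_id),
    fun k hk => ⟨(g ((k + 1 : ℕ) / n) - g (k / n)) * n,
      g (k / n) - (g ((k + 1 : ℕ) / n) - g (k / n)) * k, fun x hx => ?_⟩, fun x hx => ?_⟩
  · have h₀ := (div_le_iff₀' hn').mp hx.1
    have h₁ := (le_div_iff₀' hn').mp hx.2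
    dsimp only
    rw [linearInterpolant_eq _ hk h₀ h₁]
    ring
  · obtain ⟨k, hk, h₀, h₁⟩ := exists_nat_lt_le_le_add_one hn (mul_nonneg hn'.le hx.1)
      (mul_le_of_le_one_right hn'.le hx.2)
    have node : ∀ j : ℕ, j ≤ n → |n * x - j| ≤ 1 → |g x - g (j / n)| ≤ L * (n : ℝ) ^ (-s) := by
      intro j hj hjx
      have hj' : (j : ℝ) / n ∈ Set.Icc (0 : ℝ) 1 :=
        ⟨by positivity, (div_le_one hn').mpr (by exact_mod_cast hj)⟩
      have hdist : |x - j / n| ≤ (n : ℝ)⁻¹ := by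
        rw [show x - j / n = (n * x - j) / n by field_simp, abs_div, abs_of_pos hn', ← one_div]
        gcongr
      calc |g x - g (j / n)| ≤ L * |x - j / n| ^ s := hg x hx _ hj'
        _ ≤ L * (n : ℝ)⁻¹ ^ s := by gcongr
        _ = L * (n : ℝ) ^ (-s) := by rw [Real.inv_rpow hn'.le, Real.rpow_neg hn'.le]
    dsimp only
    rw [linearInterpolant_eq _ hk h₀ h₁]
    have hC : 0 ≤ L * (n : ℝ) ^ (-s) := by positivity
    have hle : L * (n : ℝ) ^ (-s) ≤ 2 * L * (n : ℝ) ^ (-s) := by linarith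
    refine (abs_sub_lineMap_le (by linarith) (by linarith) (node k hk.le ?_)
      (node (k + 1) hk ?_)).trans hle
    · rw [abs_le]; constructor <;> linarith
    · rw [abs_le]; push_cast; constructor <;> linarith
end
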